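/- Define g(x) = x(2 + sin log x) for x ≥ 1, with inverse g^{-1}: [2,∞) → [1,∞). Let X_P be a standard Pareto random variable, B an independent random variable uniform on {0,1}, Y = B·X_P + (1-B)·(-g^{-1}(2·X_P)), and let X_L and Y_L be the Laplace-scale transforms of X_P and Y. Then almost surely on the event {X_L > 0}: if B = 1 then Y_L = log 2 + X_L, and if B = 0 then Y_L = -log 2 - X_L. -/

import Mathlib

open MeasureTheory ProbabilityTheory Filter Set

/-- Inverse CDF of the standard Laplace distribution. -/
noncomputable def lapInv (p : ℝ) : ℝ :=
  if p ≤ 1/2 then Real.log (2 * p) else -Real.log (2 * (1 - p))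

open Real in
lemma strictMonoOn_mul_two_add_sin_log :
    StrictMonoOn (fun x : ℝ => x * (2 + sin (log x))) (Ici 1) := by
  have hd : ∀ x : ℝ, 1 ≤ x → HasDerivAt (fun x : ℝ => x * (2 + sin (log x)))
      (1 * (2 + sin (log x)) + x * (cos (log x) * x⁻¹)) x := fun x hx =>
    (hasDerivAt_id x).mul (((Real.hasDerivAt_log (by linarith)).sin).const_add 2)
  refine strictMonoOn_of_deriv_pos (convex_Ici 1)
    (fun x hx => (hd x hx).continuousAt.continuousWithinAt) fun x hx => ?_
  rw [interior_Ici, mem_Ioi] at hx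
  rw [(hd x hx.le).deriv]
  have hcos : x * (cos (log x) * x⁻¹) = cos (log x) := by
    field_simp
  rw [hcos]
  nlinarith [sin_sq_add_cos_sq (log x), neg_one_le_sin (log x), neg_one_le_cos (log x)]

lemma two_lt_of_lapInv_pos {x : ℝ} (hx : 1 < x) (h : 0 < lapInv (1 - 1 / x)) : 2 < x := by
  by_contra! hx2
  have h1 : 1 / 2 ≤ 1 / x := one_div_le_one_div_of_le (by linarith) hx2
  have h2 : 1 / x < 1 := (div_lt_one (by linarith)).2 hx
  rw [lapInv, if_pos (by linarith)] at h
  exact absurd h (Real.log_nonpos (by linarith) (by linarith)).not_gt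

lemma lapInv_one_sub {q : ℝ} (hq : q < 1 / 2) : lapInv (1 - q) = -Real.log (2 * q) := by
  rw [lapInv, if_neg (by linarith)]
  ring_nf

lemma lapInv_one_sub_one_div {x : ℝ} (hx : 2 < x) :
    lapInv (1 - 1 / x) = Real.log x - Real.log 2 := by
  rw [lapInv_one_sub (one_div_lt_one_div_of_lt two_pos hx), mul_one_div,
    Real.log_div two_ne_zero (by linarith)]
  ring

section Pareto

variable {Ω : Type*} [MeasurableSpace Ω] {μ : Measure Ω} {X : Ω → ℝ}

lemma pareto_real_Iic
    (hX : ∀ x : ℝ, μ {ω | X ω ≤ x} = if x < 1 then 0 else ENNReal.ofReal (1 - 1 / x))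
    {x : ℝ} (hx : 1 ≤ x) : μ.real (X ⁻¹' Iic x) = 1 - 1 / x := by
  have h : 1 / x ≤ 1 := (div_le_one (by linarith)).2 hx
  change (μ {ω | X ω ≤ x}).toReal = _
  rw [hX, if_neg hx.not_gt, ENNReal.toReal_ofReal (by linarith)]

lemma pareto_ae_one_lt
    (hX : ∀ x : ℝ, μ {ω | X ω ≤ x} = if x < 1 then 0 else ENNReal.ofReal (1 - 1 / x)) :
    ∀ᵐ ω ∂μ, 1 < X ω := by
  have h : μ {ω | X ω ≤ 1} = 0 := by simp [hX]
  simpa [ae_iff] using h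

lemma pareto_real_Ioi [IsProbabilityMeasure μ] (hXm : Measurable X)
    (hX : ∀ x : ℝ, μ {ω | X ω ≤ x} = if x < 1 then 0 else ENNReal.ofReal (1 - 1 / x))
    {x : ℝ} (hx : 1 ≤ x) : μ.real (X ⁻¹' Ioi x) = 1 / x := by
  rw [← compl_Iic, preimage_compl, probReal_compl_eq_one_sub (hXm measurableSet_Iic),
    pareto_real_Iic hX hx]
  ring

lemma pareto_real_Ici [IsProbabilityMeasure μ] (hXm : Measurable X)
    (hX : ∀ x : ℝ, μ {ω | X ω ≤ x} = if x < 1 then 0 else ENNReal.ofReal (1 - 1 / x))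
    {x : ℝ} (hx : 1 ≤ x) : μ.real (X ⁻¹' Ici x) = 1 / x := by
  have hlow : 1 / x ≤ μ.real (X ⁻¹' Ici x) := by
    rw [← pareto_real_Ioi hXm hX hx]
    exact measureReal_mono (preimage_mono Ioi_subset_Ici_self)
  have hpos : 0 < μ.real (X ⁻¹' Ici x) := lt_of_lt_of_le (by positivity) hlow
  refine le_antisymm ?_ hlow
  rw [le_one_div hpos (by linarith)]
  refine le_of_forall_lt_imp_le_of_dense fun y hy => ?_
  rcases le_or_gt 1 y with h1 | h1
  · rw [le_one_div (by linarith) hpos, ← pareto_real_Ioi hXm hX h1]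
    exact measureReal_mono (preimage_mono (Ici_subset_Ioi.2 hy))
  · exact h1.le.trans ((one_le_div hpos).2 measureReal_le_one)

end Pareto

theorem stmt12 {Ω : Type*} [MeasurableSpace Ω] (μ : Measure Ω) [IsProbabilityMeasure μ]
    (X B : Ω → ℝ) (hXm : Measurable X) (hBm : Measurable B)
    (hX : ∀ x : ℝ, μ {ω | X ω ≤ x} = if x < 1 then 0 else ENNReal.ofReal (1 - 1 / x))
    (hBvals : ∀ ω, B ω = 0 ∨ B ω = 1)
    (hB0 : μ {ω | B ω = 0} = 1/2) (hB1 : μ {ω | B ω = 1} = 1/2)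
    (hindep : IndepFun B X μ)
    (g : ℝ → ℝ) (hg : ∀ x : ℝ, g x = x * (2 + Real.sin (Real.log x)))
    (ginv : ℝ → ℝ)
    (hginv1 : ∀ x : ℝ, 1 ≤ x → ginv (g x) = x)
    (hginv2 : ∀ y : ℝ, 2 ≤ y → 1 ≤ ginv y ∧ g (ginv y) = y)
    (Y : Ω → ℝ) (hY : ∀ ω, Y ω = B ω * X ω + (1 - B ω) * (-(ginv (2 * X ω))))
    (XL YL : Ω → ℝ)
    (hXL : ∀ ω, XL ω = lapInv (1 - 1 / X ω))
    (hYL : ∀ ω, YL ω = lapInv ((μ {ω' | Y ω' ≤ Y ω}).toReal)) :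
    ∀ᵐ ω ∂μ, 0 < XL ω →
      ((B ω = 1 → YL ω = Real.log 2 + XL ω) ∧
       (B ω = 0 → YL ω = -Real.log 2 - XL ω)) := by
  have hX1 := pareto_ae_one_lt hX
  have hprob (b : ℝ) (hb : μ {ω | B ω = b} = 1 / 2) {s : Set ℝ} (hs : MeasurableSet s) :
      μ.real (B ⁻¹' {b} ∩ X ⁻¹' s) = 1 / 2 * μ.real (X ⁻¹' s) := by
    have hb' : μ (B ⁻¹' {b}) = 1 / 2 := hb
    rw [measureReal_def, hindep.measure_inter_preimage_eq_mul _ _ (measurableSet_singleton b) hs,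
      ENNReal.toReal_mul, hb', measureReal_def]
    norm_num
  have hY0 (ω : Ω) (h : B ω = 0) : Y ω = -ginv (2 * X ω) := by simp [hY, h]
  have hY1 (ω : Ω) (h : B ω = 1) : Y ω = X ω := by simp [hY, h]
  have hginv_le {x y : ℝ} (hx : 1 < x) (hy : 1 < y) :
      ginv (2 * x) ≤ ginv (2 * y) ↔ x ≤ y := by
    obtain ⟨hx1, hx2⟩ := hginv2 (2 * x) (by linarith)
    obtain ⟨hy1, hy2⟩ := hginv2 (2 * y) (by linarith)
    rw [← strictMonoOn_mul_two_add_sin_log.le_iff_le hx1 hy1]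
    simp only [← hg, hx2, hy2]
    constructor <;> intro h <;> linarith
  filter_upwards [hX1] with ω hω hpos
  rw [hXL] at hpos ⊢
  have h2 := two_lt_of_lapInv_pos hω hpos
  rw [lapInv_one_sub_one_div h2, hYL]
  refine ⟨fun hb => ?_, fun hb => ?_⟩
  · have hset : {ω' | Y ω' ≤ Y ω} =ᵐ[μ] ((B ⁻¹' {1} ∩ X ⁻¹' Ioi (X ω))ᶜ : Set Ω) := by
      filter_upwards [hX1] with ω' hω'
      refine propext (?_ : Y ω' ≤ Y ω ↔ ¬ (B ω' = 1 ∧ X ω < X ω'))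
      rw [hY1 ω hb]
      rcases hBvals ω' with h | h
      · have := (hginv2 (2 * X ω') (by linarith)).1
        simp only [hY0 ω' h, h, zero_ne_one, false_and, not_false_eq_true, iff_true]
        linarith
      · simp [hY1 ω' h, h]
    rw [measure_congr hset, ← measureReal_def, probReal_compl_eq_one_sub
      ((hBm (measurableSet_singleton 1)).inter (hXm measurableSet_Ioi)),
      hprob 1 hB1 measurableSet_Ioi, pareto_real_Ioi hXm hX hω.le, lapInv_one_sub]
    · rw [show 2 * (1 / 2 * (1 / X ω)) = (X ω)⁻¹ by ring, Real.log_inv]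
      ring
    · linarith [(div_lt_one (by linarith)).2 hω]
  · have hset : {ω' | Y ω' ≤ Y ω} =ᵐ[μ] (B ⁻¹' {0} ∩ X ⁻¹' Ici (X ω) : Set Ω) := by
      filter_upwards [hX1] with ω' hω'
      refine propext (?_ : Y ω' ≤ Y ω ↔ B ω' = 0 ∧ X ω ≤ X ω')
      rw [hY0 ω hb]
      rcases hBvals ω' with h | h
      · simp [hY0 ω' h, h, hginv_le hω hω']
      · have := (hginv2 (2 * X ω) (by linarith)).1
        simp only [hY1 ω' h, h, one_ne_zero, false_and, iff_false, not_le]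
        linarith
    rw [measure_congr hset, ← measureReal_def, hprob 0 hB0 measurableSet_Ici,
      pareto_real_Ici hXm hX hω.le, lapInv, if_pos]
    · rw [show 2 * (1 / 2 * (1 / X ω)) = (X ω)⁻¹ by ring, Real.log_inv]
      ring
    · linarith [(div_lt_one (by linarith)).2 hω]
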